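/- arXiv:2403.07004 — 9 statements merged into one kernel-verified Lean document; each statement's English description precedes it below -/
import Mathlib

section
/- Let c, C > 0 and m ∈ ℕ. Let y, y' ∈ ℝ^m and let I ⊆ {1,…,m} be the set of positions where y and y' differ. Assume y'_i ≤ y_i + C for all i ∈ I, and assume there exists i* ∈ I with y'_{i*} = max_{i ∈ I} y'_i and y'_{i*} ≤ y_{i*} − c. Then E_{1+C/c}(y) ≥ E_{1+C/c}(y') + c. -/
/-- The energy `E_k(y) = ∑_{i=1}^m k^i · sort(y)_i`, where `sort(y)` is `y`
sorted in ascending order. -/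
noncomputable def energy (m : ℕ) (k : ℝ) (y : Fin m → ℝ) : ℝ :=
  ∑ i : Fin m, k ^ ((i : ℕ) + 1) * y (Tuple.sort y i)

/-- Among all ways to list the entries of `y`, the ascending one maximizes the sum weighted by
increasing powers of `k ≥ 1`. -/
theorem sum_pow_mul_comp_perm_le_energy (m : ℕ) {k : ℝ} (hk : 1 ≤ k) (y : Fin m → ℝ)
    (τ : Equiv.Perm (Fin m)) :
    ∑ j : Fin m, k ^ ((j : ℕ) + 1) * y (τ j) ≤ energy m k y := by
  have hpow : Monotone fun j : Fin m => k ^ ((j : ℕ) + 1) := fun i j hij =>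
    pow_le_pow_right₀ hk (Nat.add_le_add_right hij 1)
  have h := (hpow.monovary (Tuple.monotone_sort y)).sum_mul_comp_perm_le_sum_mul
    (σ := (Tuple.sort y)⁻¹ * τ)
  simpa [energy] using h

/-- A sorting permutation can be chosen so that a maximizer `a` of `y` on a set `I` is listed last
among the elements of `I`. -/
theorem exists_perm_energy_eq_and_le_symm {m : ℕ} (k : ℝ) (y : Fin m → ℝ) (I : Finset (Fin m))
    {a : Fin m} (ha : a ∈ I) (hmax : ∀ i ∈ I, y i ≤ y a) :
    ∃ τ : Equiv.Perm (Fin m), energy m k y = ∑ j : Fin m, k ^ ((j : ℕ) + 1) * y (τ j) ∧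
      ∀ j, τ j ∈ I → j ≤ τ.symm a := by
  set σ := Tuple.sort y with hσ
  obtain ⟨b, hb, hlast⟩ := I.exists_max_image σ.symm ⟨a, ha⟩
  have hab : y b = y a := by
    refine le_antisymm (hmax b hb) ?_
    simpa [← hσ] using Tuple.monotone_sort y (hlast a ha)
  have hy : ∀ i, y (Equiv.swap a b i) = y i := fun i => by
    rw [Equiv.swap_apply_def]
    split_ifs with h₁ h₂ <;> simp_all
  have hI : ∀ i, Equiv.swap a b i ∈ I → i ∈ I := fun i => by
    rw [Equiv.swap_apply_def]
    split_ifs with h₁ h₂ <;> simp_all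
  refine ⟨σ.trans (Equiv.swap a b), ?_, fun j hj => ?_⟩
  · simp [energy, hy, ← hσ]
  · simpa using hlast (σ j) (hI _ hj)

theorem sum_range_pow_mul_ite (k c : ℝ) (r n : ℕ) :
    ∑ j ∈ Finset.range n,
        k ^ (j + 1) * (if j < r then -(c * (k - 1)) else if j = r then c else 0) =
      if n ≤ r then c * (k - k ^ (n + 1)) else c * k := by
  induction n with
  | zero => simp
  | succ n ih =>
    rw [Finset.sum_range_succ, ih]
    rcases lt_trichotomy n r with h | h | h
    · rw [if_pos h.le, if_pos h, if_pos (Nat.succ_le_of_lt h)]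
      ring
    · subst h
      simp
      ring
    · rw [if_neg (by lia), if_neg (by lia), if_neg (by lia), if_neg (by lia)]
      ring

/-- if `y'` differs from `y` on a set `I` of positions, increases by at most `C`
on `I`, and there is a position `i*` of `I` maximizing `y'` on `I` where `y'` decreased by at
least `c`, then the energy with base `1 + C/c` decreases by at least `c`. -/
theorem energy_decrease (m : ℕ) (c C : ℝ) (hc : 0 < c) (hC : 0 < C)
    (y y' : Fin m → ℝ)
    (hbound : ∀ i : Fin m, y i ≠ y' i → y' i ≤ y i + C)
    (istar : Fin m) (histar : y istar ≠ y' istar)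
    (hmax : ∀ i : Fin m, y i ≠ y' i → y' i ≤ y' istar)
    (hdec : y' istar ≤ y istar - c) :
    energy m (1 + C / c) y' + c ≤ energy m (1 + C / c) y := by
  set k : ℝ := 1 + C / c with hk
  have hk1 : 1 ≤ k := by
    have := div_pos hC hc
    linarith
  have hCk : c * (k - 1) = C := by
    rw [hk]
    field_simp
    ring
  obtain ⟨τ, hτ, hlast⟩ := exists_perm_energy_eq_and_le_symm k y'
    (Finset.univ.filter fun i => y i ≠ y' i) (a := istar) (by simpa using histar)
    (by simpa using hmax)
  set r := τ.symm istar with hr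
  have hdiff : ∀ j : Fin m,
      (if (j : ℕ) < r then -(c * (k - 1)) else if (j : ℕ) = r then c else 0) ≤
        y (τ j) - y' (τ j) := by
    intro j
    by_cases hj : y (τ j) = y' (τ j)
    · have hne : (j : ℕ) ≠ r := fun h => by
        rw [Fin.ext h, hr, Equiv.apply_symm_apply] at hj
        exact histar hj
      rw [if_neg hne, hj, sub_self, hCk]
      split_ifs <;> linarith
    · rcases (hlast j (by simpa using hj)).lt_or_eq with h | h
      · rw [if_pos (Fin.lt_def.mp h), hCk]
        linarith [hbound _ hj]
      · rw [h, if_neg (lt_irrefl _), if_pos rfl, hr, Equiv.apply_symm_apply]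
        linarith
  have hsum : c * k ≤ ∑ j : Fin m, k ^ ((j : ℕ) + 1) * (y (τ j) - y' (τ j)) := by
    calc c * k = ∑ j : Fin m, k ^ ((j : ℕ) + 1) *
          (if (j : ℕ) < r then -(c * (k - 1)) else if (j : ℕ) = r then c else 0) := by
          rw [Fin.sum_univ_eq_sum_range (fun j : ℕ => k ^ (j + 1) *
            (if j < (r : ℕ) then -(c * (k - 1)) else if j = (r : ℕ) then c else 0)),
            sum_range_pow_mul_ite, if_neg r.isLt.not_ge]
      _ ≤ _ := Finset.sum_le_sum fun j _ => mul_le_mul_of_nonneg_left (hdiff j) (by positivity)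
  have hle := sum_pow_mul_comp_perm_le_energy m hk1 y τ
  simp only [mul_sub, Finset.sum_sub_distrib] at hsum
  have hck : c ≤ c * k := le_mul_of_one_le_right hc.le hk1
  linarith
end

section
/- Let A ∈ ℝ^{m×n} satisfy sign consistency and let b ∈ ℝ^m. Fix j ∈ {1,…,n} and fix values x_k ∈ ℝ for all k ≠ j. Then the univariate function t ↦ g_j(x) (where x_j is set to t) has exactly one minimizer t*, and t* is the unique real number t such that max_{i : a_{ij} < 0} (a_i^T x + b_i) = max_{i : a_{ij} > 0} (a_i^T x + b_i) holds when x_j = t. -/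
/-- Sign consistency: every column of `A` has a negative and a positive entry. -/
def SignConsistent {m n : ℕ} (A : Matrix (Fin m) (Fin n) ℝ) : Prop :=
  ∀ j : Fin n, (∃ i, A i j < 0) ∧ (∃ i, 0 < A i j)

/-- `g_j(x) = max_{i : a_{ij} ≠ 0} (a_i^T x + b_i)`. -/
noncomputable def g {m n : ℕ} (A : Matrix (Fin m) (Fin n) ℝ) (b : Fin m → ℝ)
    (j : Fin n) (x : Fin n → ℝ) : ℝ :=
  ⨆ i : {i : Fin m // A i j ≠ 0}, (∑ l, A i.1 l * x l + b i.1)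

/-- `max_{i : a_{ij} < 0} (a_i^T x + b_i)`. -/
noncomputable def negMax {m n : ℕ} (A : Matrix (Fin m) (Fin n) ℝ) (b : Fin m → ℝ)
    (j : Fin n) (x : Fin n → ℝ) : ℝ :=
  ⨆ i : {i : Fin m // A i j < 0}, (∑ l, A i.1 l * x l + b i.1)

/-- `max_{i : a_{ij} > 0} (a_i^T x + b_i)`. -/
noncomputable def posMax {m n : ℕ} (A : Matrix (Fin m) (Fin n) ℝ) (b : Fin m → ℝ)
    (j : Fin n) (x : Fin n → ℝ) : ℝ :=
  ⨆ i : {i : Fin m // 0 < A i j}, (∑ l, A i.1 l * x l + b i.1)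

open Filter Topology in
/-- A finite maximum of affine functions with positive slopes is continuous, strictly increasing
and tends to infinity. -/
theorem iSup_affine_continuous_strictMono_tendsto {ι : Type*} [Finite ι] [Nonempty ι]
    (c d : ι → ℝ) (hc : ∀ i, 0 < c i) :
    Continuous (fun t : ℝ => ⨆ i, (c i * t + d i)) ∧
      StrictMono (fun t : ℝ => ⨆ i, (c i * t + d i)) ∧
      Tendsto (fun t : ℝ => ⨆ i, (c i * t + d i)) atTop atTop := by
  have hle (t : ℝ) (i : ι) : c i * t + d i ≤ ⨆ i, (c i * t + d i) :=
    le_ciSup (f := fun i => c i * t + d i) (Set.finite_range _).bddAbove i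
  refine ⟨?_, ?_, ?_⟩
  · cases nonempty_fintype ι
    simp_rw [← Finset.sup'_univ_eq_ciSup]
    exact Continuous.finset_sup'_apply _ fun i _ => by fun_prop
  · intro s t hst
    obtain ⟨i, hi⟩ := exists_eq_ciSup_of_finite (f := fun i => c i * s + d i)
    change (⨆ i, (c i * s + d i)) < ⨆ i, (c i * t + d i)
    rw [← hi]
    refine lt_of_lt_of_le ?_ (hle t i)
    have := mul_lt_mul_of_pos_left hst (hc i)
    linarith
  · obtain ⟨i⟩ := ‹Nonempty ι›
    refine tendsto_atTop_mono (fun t => hle t i) ?_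
    exact tendsto_atTop_add_const_right _ _ (tendsto_id.const_mul_atTop (hc i))

open Filter Topology in
/-- The maximum of a strictly decreasing function `t ↦ Q (-t)` and a strictly increasing function
`P`, both continuous and coercive, has a unique minimizer, which is their crossing point. -/
theorem existsUnique_min_max_of_strictMono {P Q : ℝ → ℝ}
    (hPc : Continuous P) (hPm : StrictMono P) (hPt : Tendsto P atTop atTop)
    (hQc : Continuous Q) (hQm : StrictMono Q) (hQt : Tendsto Q atTop atTop) :
    (∃! t : ℝ, ∀ s : ℝ, max (Q (-t)) (P t) ≤ max (Q (-s)) (P s)) ∧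
    (∀ t : ℝ, (∀ s : ℝ, max (Q (-t)) (P t) ≤ max (Q (-s)) (P s)) ↔ Q (-t) = P t) := by
  obtain ⟨t₀, h₀⟩ : ∃ t, Q (-t) = P t := by
    obtain ⟨u, hu, hu0⟩ := ((hPt.eventually_ge_atTop (Q 0)).and (eventually_ge_atTop 0)).exists
    obtain ⟨v, hv, hv0⟩ := ((hQt.eventually_ge_atTop (P 0)).and (eventually_ge_atTop 0)).exists
    refine mem_range_of_exists_le_of_exists_ge (c := 0) (f := fun t => Q (-t) - P t)
      (by fun_prop) ⟨u, ?_⟩ ⟨-v, ?_⟩ |>.imp fun t ht => sub_eq_zero.mp ht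
    · have := hQm.monotone (show -u ≤ 0 by linarith)
      linarith
    · have := hPm.monotone (show -v ≤ 0 by linarith)
      simp only [neg_neg]
      linarith
  have strict_min {t s : ℝ} (ht : Q (-t) = P t) (hst : s ≠ t) :
      max (Q (-t)) (P t) < max (Q (-s)) (P s) := by
    rw [ht, max_self]
    rcases hst.lt_or_gt with h | h
    · exact lt_max_of_lt_left (ht ▸ hQm (neg_lt_neg h))
    · exact lt_max_of_lt_right (hPm h)
  have is_min {t : ℝ} (ht : Q (-t) = P t) (s : ℝ) : max (Q (-t)) (P t) ≤ max (Q (-s)) (P s) := by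
    rcases eq_or_ne s t with rfl | h
    · exact le_rfl
    · exact (strict_min ht h).le
  have eq_of_min {t : ℝ} (ht : ∀ s : ℝ, max (Q (-t)) (P t) ≤ max (Q (-s)) (P s)) : t = t₀ := by
    by_contra h
    exact (strict_min h₀ h).not_ge (ht t₀)
  exact ⟨⟨t₀, is_min h₀, fun t ht => eq_of_min ht⟩,
    fun t => ⟨fun ht => eq_of_min ht ▸ h₀, is_min⟩⟩

theorem g_eq_max_negMax_posMax {m n : ℕ} {A : Matrix (Fin m) (Fin n) ℝ} (hsc : SignConsistent A)
    (b : Fin m → ℝ) (j : Fin n) (x : Fin n → ℝ) :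
    g A b j x = max (negMax A b j x) (posMax A b j x) := by
  obtain ⟨⟨p, hp⟩, q, hq⟩ := hsc j
  have : Nonempty {i // A i j < 0} := ⟨p, hp⟩
  have : Nonempty {i // 0 < A i j} := ⟨q, hq⟩
  have : Nonempty {i // A i j ≠ 0} := ⟨p, hp.ne⟩
  unfold g negMax posMax
  refine le_antisymm (ciSup_le fun i => ?_) (max_le (ciSup_le fun i => ?_) (ciSup_le fun i => ?_))
  · rcases i.2.lt_or_gt with h | h
    · exact le_max_of_le_left (le_ciSup
        (f := fun i : {i // A i j < 0} => ∑ l, A i.1 l * x l + b i.1)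
        (Set.finite_range _).bddAbove ⟨i.1, h⟩)
    · exact le_max_of_le_right (le_ciSup
        (f := fun i : {i // 0 < A i j} => ∑ l, A i.1 l * x l + b i.1)
        (Set.finite_range _).bddAbove ⟨i.1, h⟩)
  · exact le_ciSup (f := fun i : {i // A i j ≠ 0} => ∑ l, A i.1 l * x l + b i.1)
      (Set.finite_range _).bddAbove ⟨i.1, i.2.ne⟩
  · exact le_ciSup (f := fun i : {i // A i j ≠ 0} => ∑ l, A i.1 l * x l + b i.1)
      (Set.finite_range _).bddAbove ⟨i.1, i.2.ne'⟩

theorem sum_mul_update_eq {ι : Type*} [Fintype ι] [DecidableEq ι] (a x : ι → ℝ) (j : ι) (t : ℝ) :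
    ∑ l, a l * Function.update x j t l = a j * t + ∑ l, a l * Function.update x j 0 l := by
  rw [← Finset.add_sum_erase _ _ (Finset.mem_univ j),
    ← Finset.add_sum_erase _ (fun l => a l * Function.update x j 0 l) (Finset.mem_univ j)]
  simp only [Function.update_self, mul_zero, zero_add]
  congr 1
  refine Finset.sum_congr rfl fun l hl => ?_
  simp [Function.update_of_ne (Finset.ne_of_mem_erase hl)]

/-- under sign consistency, the univariate function `t ↦ g_j(x)` (with `x_j := t`)
has exactly one minimizer, and a value `t` is the minimizer iff the max of the decreasing
affine functions equals the max of the increasing ones at `x_j := t`. -/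
theorem gj_existsUnique_min (m n : ℕ) (A : Matrix (Fin m) (Fin n) ℝ) (b : Fin m → ℝ)
    (hsc : SignConsistent A) (j : Fin n) (x : Fin n → ℝ) :
    (∃! t : ℝ, ∀ s : ℝ,
        g A b j (Function.update x j t) ≤ g A b j (Function.update x j s)) ∧
    (∀ t : ℝ,
        (∀ s : ℝ, g A b j (Function.update x j t) ≤ g A b j (Function.update x j s)) ↔
        negMax A b j (Function.update x j t) = posMax A b j (Function.update x j t)) := by
  obtain ⟨⟨p, hp⟩, q, hq⟩ := hsc j
  have : Nonempty {i // A i j < 0} := ⟨p, hp⟩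
  have : Nonempty {i // 0 < A i j} := ⟨q, hq⟩
  let d : Fin m → ℝ := fun i => ∑ l, A i l * Function.update x j 0 l + b i
  have hterm (i : Fin m) (t : ℝ) :
      ∑ l, A i l * Function.update x j t l + b i = A i j * t + d i := by
    rw [sum_mul_update_eq, add_assoc]
  obtain ⟨hPc, hPm, hPt⟩ := iSup_affine_continuous_strictMono_tendsto
    (fun i : {i // 0 < A i j} => A i.1 j) (fun i => d i.1) fun i => i.2
  obtain ⟨hQc, hQm, hQt⟩ := iSup_affine_continuous_strictMono_tendsto
    (fun i : {i // A i j < 0} => -A i.1 j) (fun i => d i.1) fun i => neg_pos.mpr i.2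
  have key := existsUnique_min_max_of_strictMono hPc hPm hPt hQc hQm hQt
  simp_rw [g_eq_max_negMax_posMax hsc]
  simp only [negMax, posMax, hterm]
  simpa only [neg_mul_neg] using key
end

section
/- Let A ∈ {−1,0,1}^{m×n} satisfy sign consistency and let b ∈ ℝ^m. Fix j ∈ {1,…,n}, x ∈ ℝ^n, and let x^{−j} ∈ ℝ^n agree with x except that x^{−j}_j = 0. Then the unique minimizer of the univariate function t ↦ g_j(x) (where x_j is set to t) is t* = (1/2)·( max_{i : a_{ij} < 0} (a_i^T x^{−j} + b_i) − max_{i : a_{ij} > 0} (a_i^T x^{−j} + b_i) ). -/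
theorem sum_mul_update_eq_add {n : ℕ} (a x : Fin n → ℝ) (j : Fin n) (t : ℝ) :
    ∑ l, a l * Function.update x j t l = ∑ l, a l * Function.update x j 0 l + a j * t := by
  rw [← Fintype.sum_ite_eq j fun l => a l * t, ← Finset.sum_add_distrib]
  refine Finset.sum_congr rfl fun l _ => ?_
  rcases eq_or_ne l j with rfl | h
  · simp
  · simp [h, h.symm]

/-- Along the `j`-th coordinate, `g_j` is the maximum of a line of slope `-1` and one of
slope `1`. -/
theorem g_update_eq_max {m n : ℕ} (A : Matrix (Fin m) (Fin n) ℝ) (b : Fin m → ℝ)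
    (hA : ∀ i j, A i j = -1 ∨ A i j = 0 ∨ A i j = 1)
    (hsc : SignConsistent A) (j : Fin n) (x : Fin n → ℝ) (t : ℝ) :
    g A b j (Function.update x j t) =
      max (negMax A b j (Function.update x j 0) - t)
        (posMax A b j (Function.update x j 0) + t) := by
  obtain ⟨⟨i₁, h₁⟩, ⟨i₂, h₂⟩⟩ := hsc j
  have : Nonempty {i : Fin m // A i j ≠ 0} := ⟨⟨i₁, h₁.ne⟩⟩
  have : Nonempty {i : Fin m // A i j < 0} := ⟨⟨i₁, h₁⟩⟩
  have : Nonempty {i : Fin m // 0 < A i j} := ⟨⟨i₂, h₂⟩⟩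
  have neg_eq {i : Fin m} (hi : A i j < 0) : A i j = -1 := by
    rcases hA i j with h | h | h <;> linarith
  have pos_eq {i : Fin m} (hi : 0 < A i j) : A i j = 1 := by
    rcases hA i j with h | h | h <;> linarith
  unfold g negMax posMax
  apply le_antisymm
  · refine ciSup_le fun i => ?_
    rw [sum_mul_update_eq_add]
    rcases lt_or_gt_of_ne i.2 with hi | hi
    · have := le_ciSup (Set.finite_range fun i : {i : Fin m // A i j < 0} =>
        ∑ l, A i.1 l * Function.update x j 0 l + b i.1).bddAbove ⟨i.1, hi⟩
      apply le_max_of_le_left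
      rw [neg_eq hi]
      linarith
    · have := le_ciSup (Set.finite_range fun i : {i : Fin m // 0 < A i j} =>
        ∑ l, A i.1 l * Function.update x j 0 l + b i.1).bddAbove ⟨i.1, hi⟩
      apply le_max_of_le_right
      rw [pos_eq hi]
      linarith
  · have row_le (i : Fin m) (hi : A i j ≠ 0) :=
      le_ciSup (Set.finite_range fun i : {i : Fin m // A i j ≠ 0} =>
        ∑ l, A i.1 l * Function.update x j t l + b i.1).bddAbove ⟨i, hi⟩
    refine max_le ?_ ?_
    · rw [sub_le_iff_le_add]
      refine ciSup_le fun i => ?_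
      have := row_le i.1 i.2.ne
      have := sum_mul_update_eq_add (A i.1) x j t
      rw [neg_eq i.2] at this
      linarith
    · rw [← le_sub_iff_add_le]
      refine ciSup_le fun i => ?_
      have := row_le i.1 i.2.ne'
      have := sum_mul_update_eq_add (A i.1) x j t
      rw [pos_eq i.2] at this
      linarith

/-- if `A ∈ {−1,0,1}^{m×n}` is sign consistent, then the unique minimizer of
`t ↦ g_j(x)` (with `x_j := t`) is
`t* = ½ (max_{i : a_{ij}<0} (a_i^T x^{−j} + b_i) − max_{i : a_{ij}>0} (a_i^T x^{−j} + b_i))`,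
where `x^{−j}` agrees with `x` except `x^{−j}_j = 0`. -/
theorem gj_min_closed_form (m n : ℕ) (A : Matrix (Fin m) (Fin n) ℝ) (b : Fin m → ℝ)
    (hA : ∀ i j, A i j = -1 ∨ A i j = 0 ∨ A i j = 1)
    (hsc : SignConsistent A) (j : Fin n) (x : Fin n → ℝ) :
    (∀ s : ℝ,
        g A b j (Function.update x j
          ((negMax A b j (Function.update x j 0) - posMax A b j (Function.update x j 0)) / 2))
        ≤ g A b j (Function.update x j s)) ∧
    (∀ t : ℝ,
        (∀ s : ℝ, g A b j (Function.update x j t) ≤ g A b j (Function.update x j s)) →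
        t = (negMax A b j (Function.update x j 0)
              - posMax A b j (Function.update x j 0)) / 2) := by
  simp only [g_update_eq_max A b hA hsc]
  generalize negMax A b j (Function.update x j 0) = N
  generalize posMax A b j (Function.update x j 0) = P
  refine ⟨fun s => ?_, fun t ht => ?_⟩
  · have := le_max_left (N - s) (P + s)
    have := le_max_right (N - s) (P + s)
    exact max_le (by linarith) (by linarith)
  · have h := ht ((N - P) / 2)
    rw [show P + (N - P) / 2 = N - (N - P) / 2 by ring, max_self] at h
    have := le_max_left (N - t) (P + t)
    have := le_max_right (N - t) (P + t)
    linarith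
end

section
/- Let A ∈ ℝ^{m×n} satisfy sign consistency, b ∈ ℝ^m, c = min_{i,j : a_{ij} ≠ 0} |a_{ij}|, C = max_{i,j} |a_{ij}|. Fix x ∈ ℝ^n and j ∈ {1,…,n}, let x*_j be the unique minimizer of the univariate function t ↦ g_j(x) (x_j set to t), and let x' ∈ ℝ^n be equal to x except x'_j = x*_j. Then E_{1+C/c}(Ax' + b) ≤ E_{1+C/c}(Ax + b) − c·|x_j − x*_j|. -/
/-- Sorting maximizes the weighted sum defining the energy, if the weights are increasing. -/
lemma sum_pow_mul_perm_le_energy {m : ℕ} {k : ℝ} (hk : 1 ≤ k) (y : Fin m → ℝ)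
    (σ : Equiv.Perm (Fin m)) :
    ∑ i : Fin m, k ^ ((i : ℕ) + 1) * y (σ i) ≤ energy m k y := by
  have hweights : Monotone fun i : Fin m => k ^ ((i : ℕ) + 1) := fun i j hij =>
    pow_le_pow_right₀ hk (Nat.succ_le_succ hij)
  have h := (hweights.monovary (Tuple.monotone_sort y)).sum_mul_comp_perm_le_sum_mul
    (σ := (Tuple.sort y)⁻¹ * σ)
  simpa [energy] using h

/-- A tie among the entries of `w` can be broken in favour of `i₀`: some sorting permutation of `w`
places `i₀` after all the other entries that are at most `w i₀`. -/
lemma exists_sorting_perm_last {m : ℕ} (k : ℝ) (w : Fin m → ℝ) (i₀ : Fin m) :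
    ∃ (σ : Equiv.Perm (Fin m)) (p : Fin m), σ p = i₀ ∧ (∀ q, p < q → w i₀ < w (σ q)) ∧
      energy m k w = ∑ i : Fin m, k ^ ((i : ℕ) + 1) * w (σ i) := by
  set τ := Tuple.sort w
  have hr : w (τ (τ.symm i₀)) = w i₀ := by simp
  obtain ⟨p, hp, hmax⟩ := (Finset.univ.filter fun q => w (τ q) = w i₀).exists_max_image id
    ⟨τ.symm i₀, by simp⟩
  simp only [Finset.mem_filter, Finset.mem_univ, true_and, id] at hp hmax
  have hw : ∀ q, w ((τ * Equiv.swap p (τ.symm i₀)) q) = w (τ q) := by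
    intro q
    rw [Equiv.Perm.mul_apply, Equiv.swap_apply_def]
    split_ifs with h₁ h₂
    · rw [hr, h₁, hp]
    · rw [hp, h₂, hr]
    · rfl
  refine ⟨τ * Equiv.swap p (τ.symm i₀), p, by simp, fun q hq => ?_, ?_⟩
  · rw [hw]
    have hle : w (τ p) ≤ w (τ q) := Tuple.monotone_sort w hq.le
    exact lt_of_le_of_ne (hp ▸ hle) fun h => hq.not_ge (hmax q h.symm)
  · exact Finset.sum_congr rfl fun q _ => by rw [hw]

/-- Moving entries by `a i * d` decreases the energy, provided that some entry `i₀` moves down and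
ends up maximal among the entries that move. -/
lemma energy_add_mul_le {m : ℕ} {c C d : ℝ} (hc : 0 < c) (hC : 0 < C) (a v w : Fin m → ℝ)
    (hw : ∀ i, w i = v i + a i * d) (hca : ∀ i, a i ≠ 0 → c ≤ |a i|) (haC : ∀ i, |a i| ≤ C)
    (i₀ : Fin m) (hi₀ : a i₀ * d < 0) (hmax : ∀ i, a i ≠ 0 → w i ≤ w i₀) :
    energy m (1 + C / c) w ≤ energy m (1 + C / c) v - c * |d| := by
  have hCc : 0 < C / c := div_pos hC hc
  set k := 1 + C / c with hk
  have hk1 : 1 ≤ k := by linarith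
  have hkC : C = c * (k - 1) := by rw [hk]; field_simp; ring
  obtain ⟨σ, p, hp, hlt, hE⟩ := exists_sorting_perm_last k w i₀
  have hgeom : C * ∑ q ∈ Finset.Iio p, k ^ ((q : ℕ) + 1) = c * (k ^ ((p : ℕ) + 1) - k) := by
    have hsum : ∑ q ∈ Finset.Iio p, k ^ ((q : ℕ) + 1) = ∑ q ∈ Finset.range p, k ^ (q + 1) := by
      rw [← Nat.Iio_eq_range, ← Fin.map_valEmbedding_Iio, Finset.sum_map]
      rfl
    have := geom_sum_mul k p
    rw [hsum, hkC]
    simp only [pow_succ, ← Finset.sum_mul]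
    linear_combination c * k * this
  have hpoint : ∀ q : Fin m, k ^ ((q : ℕ) + 1) * (a (σ q) * d) ≤
      (if q < p then k ^ ((q : ℕ) + 1) * (C * |d|) else 0) +
        if q = p then k ^ ((q : ℕ) + 1) * -(c * |d|) else 0 := by
    intro q
    have hkq : 0 ≤ k ^ ((q : ℕ) + 1) := by positivity
    rcases lt_trichotomy q p with h | rfl | h
    · rw [if_pos h, if_neg h.ne, add_zero]
      refine mul_le_mul_of_nonneg_left ((le_abs_self _).trans ?_) hkq
      rw [abs_mul]
      exact mul_le_mul_of_nonneg_right (haC _) (abs_nonneg d)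
    · rw [if_neg (lt_irrefl q), if_pos rfl, zero_add, hp]
      refine mul_le_mul_of_nonneg_left ?_ hkq
      rw [le_neg, ← abs_of_neg hi₀, abs_mul]
      exact mul_le_mul_of_nonneg_right (hca _ (left_ne_zero_of_mul hi₀.ne)) (abs_nonneg d)
    · have ha : a (σ q) = 0 := by
        by_contra hne
        exact (hlt q h).not_ge (hmax _ hne)
      simp [ha, h.not_gt, h.ne']
  have hdiff : ∑ q : Fin m, k ^ ((q : ℕ) + 1) * (a (σ q) * d) ≤ -(c * |d| * k) := by
    refine (Finset.sum_le_sum fun q _ => hpoint q).trans_eq ?_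
    rw [Finset.sum_add_distrib, Finset.sum_ite_eq' Finset.univ p, if_pos (Finset.mem_univ p),
      ← Finset.sum_filter, Finset.filter_gt_eq_Iio, ← Finset.sum_mul]
    linear_combination |d| * hgeom
  have hsplit : energy m k w = ∑ q : Fin m, k ^ ((q : ℕ) + 1) * v (σ q) +
      ∑ q : Fin m, k ^ ((q : ℕ) + 1) * (a (σ q) * d) := by
    rw [hE, ← Finset.sum_add_distrib]
    simp only [hw, mul_add]
  have := sum_pow_mul_perm_le_energy hk1 v σ
  have : c * |d| ≤ c * |d| * k := le_mul_of_one_le_right (by positivity) hk1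
  linarith

/-- Changing one coordinate of `x` moves the entries of `A x + b` along a column of `A`. -/
lemma sum_mul_update_add {m n : ℕ} (A : Matrix (Fin m) (Fin n) ℝ) (b : Fin m → ℝ)
    (x : Fin n → ℝ) (j : Fin n) (s t : ℝ) (i : Fin m) :
    ∑ l, A i l * Function.update x j s l + b i =
      ∑ l, A i l * Function.update x j t l + b i + A i j * (s - t) := by
  have h : ∀ r : ℝ, ∑ l, A i l * Function.update x j r l =
      A i j * r + ∑ l ∈ Finset.univ.erase j, A i l * x l := by
    intro r
    rw [← Finset.add_sum_erase _ _ (Finset.mem_univ j), Function.update_self]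
    congr 1
    refine Finset.sum_congr rfl fun l hl => ?_
    rw [Function.update_of_ne (Finset.ne_of_mem_erase hl)]
  rw [h, h]
  ring

/-- At a minimizer of `g_j` in the coordinate `j`, for either direction of motion there is an active
row whose value decreases in that direction. -/
lemma exists_active_row {m n : ℕ} {A : Matrix (Fin m) (Fin n) ℝ} (b : Fin m → ℝ)
    (hsc : SignConsistent A) (x : Fin n → ℝ) (j : Fin n) (t : ℝ)
    (hmin : ∀ s : ℝ, g A b j (Function.update x j t) ≤ g A b j (Function.update x j s))
    {d : ℝ} (hd : d ≠ 0) :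
    ∃ i, A i j * d < 0 ∧
      ∑ l, A i l * Function.update x j t l + b i = g A b j (Function.update x j t) := by
  by_contra! hcon
  have hle : ∀ i : {i // A i j ≠ 0}, ∑ l, A i.1 l * Function.update x j t l + b i.1 ≤
      g A b j (Function.update x j t) := fun i => le_ciSup
    (f := fun i : {i // A i j ≠ 0} => ∑ l, A i.1 l * Function.update x j t l + b i.1)
    (Set.finite_range _).bddAbove i
  have hev : ∀ᶠ ε in nhdsWithin (0 : ℝ) (Set.Ioi 0), ∀ i : {i // A i j ≠ 0},
      ∑ l, A i.1 l * Function.update x j (t - ε * d) l + b i.1 <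
        g A b j (Function.update x j t) := by
    refine Filter.eventually_all.2 fun i => ?_
    simp only [fun ε : ℝ => sum_mul_update_add A b x j (t - ε * d) t i.1]
    rcases (hle i).lt_or_eq with h | h
    · refine Filter.Eventually.filter_mono nhdsWithin_le_nhds
        (ContinuousAt.eventually_lt (by fun_prop) continuousAt_const ?_)
      simpa using h
    · have hpos : 0 < A i.1 j * d := lt_of_le_of_ne
        (not_lt.1 fun hneg => hcon i hneg h) (mul_ne_zero i.2 hd).symm
      filter_upwards [self_mem_nhdsWithin] with ε hε
      have := mul_pos (Set.mem_Ioi.1 hε) hpos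
      rw [h]
      linarith
  obtain ⟨ε, hε⟩ := hev.exists
  obtain ⟨i, hi⟩ := (hsc j).1
  have : Nonempty {i // A i j ≠ 0} := ⟨i, hi.ne⟩
  obtain ⟨i', hi'⟩ := exists_eq_ciSup_of_finite
    (f := fun i : {i // A i j ≠ 0} => ∑ l, A i.1 l * Function.update x j (t - ε * d) l + b i.1)
  exact (hmin (t - ε * d)).not_gt (hi'.symm.trans_lt (hε i'))

/-- a coordinate-descent update of coordinate `j` (replacing `x_j` by the
minimizer `x*_j` of `t ↦ g_j(x)`) decreases the energy `E_{1+C/c}(Ax+b)` by at least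
`c·|x_j − x*_j|`, where `c` is the minimal and `C` the maximal absolute value of
(nonzero) entries of `A`. -/
theorem energy_decrease_update (m n : ℕ) (A : Matrix (Fin m) (Fin n) ℝ) (b : Fin m → ℝ)
    (hsc : SignConsistent A) (c C : ℝ)
    (hc : IsLeast {r : ℝ | ∃ i j, A i j ≠ 0 ∧ r = |A i j|} c)
    (hC : IsGreatest {r : ℝ | ∃ i j, r = |A i j|} C)
    (x : Fin n → ℝ) (j : Fin n) (xstar : ℝ)
    (hmin : ∀ s : ℝ,
      g A b j (Function.update x j xstar) ≤ g A b j (Function.update x j s)) :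
    energy m (1 + C / c) (fun i => ∑ l, A i l * (Function.update x j xstar) l + b i)
      ≤ energy m (1 + C / c) (fun i => ∑ l, A i l * x l + b i) - c * |x j - xstar| := by
  rcases eq_or_ne xstar (x j) with rfl | hne
  · simp
  have hcpos : 0 < c := by
    obtain ⟨i, l, hil, rfl⟩ := hc.1
    exact abs_pos.2 hil
  have hCpos : 0 < C := by
    obtain ⟨i, l, -, hil⟩ := hc.1
    exact hcpos.trans_le (hC.2 ⟨i, l, hil⟩)
  obtain ⟨i₀, hneg, hi₀⟩ := exists_active_row b hsc x j xstar hmin (sub_ne_zero.2 hne)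
  rw [abs_sub_comm]
  refine energy_add_mul_le hcpos hCpos (fun i => A i j) _ _ (fun i => ?_)
    (fun i hi => hc.2 ⟨i, j, hi, rfl⟩) (fun i => hC.2 ⟨i, j, rfl⟩) i₀ hneg (fun i hi => ?_)
  · simpa using sum_mul_update_add A b x j xstar (x j) i
  · rw [hi₀]
    exact le_ciSup
      (f := fun i : {i // A i j ≠ 0} => ∑ l, A i.1 l * Function.update x j xstar l + b i.1)
      (Set.finite_range _).bddAbove ⟨i, hi⟩
end

section
/- Let A ∈ ℝ^{m×n} satisfy sign consistency, b ∈ ℝ^m, c = min_{i,j : a_{ij} ≠ 0} |a_{ij}|, C = max_{i,j} |a_{ij}|. Let (x^t)_{t ≥ 0} be a sequence in ℝ^n and (j_t)_{t ≥ 0} a sequence of coordinate indices such that for each t, x^{t+1} agrees with x^t in all coordinates except j_t and x^{t+1}_{j_t} is the unique minimizer of the univariate function t' ↦ g_{j_t}(x^t) (with coordinate j_t set to t'). If there is E_min ∈ ℝ with E_{1+C/c}(Ax^t + b) ≥ E_min for all t, then the sequence (x^t) converges to some x* ∈ ℝ^n, and consequently Ax^t + b converges to Ax* + b. -/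
open Filter

/-- Rearrangement inequality: the energy dominates every rank assignment. -/
theorem sum_perm_le_energy {m : ℕ} {k : ℝ} (hk : 1 ≤ k) (y : Fin m → ℝ)
    (τ : Equiv.Perm (Fin m)) :
    ∑ i : Fin m, k ^ ((i : ℕ) + 1) * y (τ i) ≤ energy m k y := by
  have hf : Monotone fun i : Fin m => k ^ ((i : ℕ) + 1) := fun i j hij =>
    pow_le_pow_right₀ hk (Nat.succ_le_succ hij)
  have h := (hf.monovary (Tuple.monotone_sort y)).sum_mul_comp_perm_le_sum_mul
    (σ := τ.trans (Tuple.sort y).symm)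
  simpa [energy] using h

/-- If `q` attains the maximum of `y` over `S`, then some sorting permutation of `y` ranks `q`
above every other element of `S`. -/
theorem exists_perm_energy_eq {m : ℕ} (k : ℝ) (y : Fin m → ℝ) (S : Set (Fin m)) {q : Fin m}
    (hq : q ∈ S) (hmax : ∀ i ∈ S, y i ≤ y q) :
    ∃ (τ : Equiv.Perm (Fin m)) (r : Fin m), τ r = q ∧ (∀ i, r < i → τ i ∉ S) ∧
      energy m k y = ∑ i : Fin m, k ^ ((i : ℕ) + 1) * y (τ i) := by
  classical
  obtain ⟨r, hr, hrmax⟩ := Set.exists_max_image {i | Tuple.sort y i ∈ S} id (Set.toFinite _)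
    ⟨(Tuple.sort y).symm q, by simpa using hq⟩
  have hyr : y (Tuple.sort y r) = y q := by
    refine le_antisymm (hmax _ hr) ?_
    have := Tuple.monotone_sort y (hrmax ((Tuple.sort y).symm q) (by simpa using hq))
    simpa using this
  refine ⟨(Tuple.sort y).trans (Equiv.swap (Tuple.sort y r) q), r, by simp, ?_, ?_⟩
  · intro i hi hmem
    have hi' : Tuple.sort y i ∉ S := fun h => (hrmax i h).not_gt hi
    rw [Equiv.trans_apply, Equiv.swap_apply_of_ne_of_ne] at hmem
    · exact hi' hmem
    · exact fun h => hi' (h ▸ hr)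
    · exact fun h => hi' (h ▸ hq)
  · refine Finset.sum_congr rfl fun i _ => ?_
    congr 1
    rw [Equiv.trans_apply, Equiv.swap_apply_def]
    split_ifs with h1 h2
    · rw [h1, hyr]
    · rw [h2, hyr]
    · rfl

/-- With ratio `1 + C / c`, a top-ranked entry at most `-c` outweighs all lower-ranked entries
of size at most `C`. -/
theorem sum_pow_mul_le {m : ℕ} {c C : ℝ} (hc : 0 < c) (hC : 0 ≤ C) (w : Fin m → ℝ) (r : Fin m)
    (hw : ∀ i, w i ≤ C) (hr : w r ≤ -c) (h0 : ∀ i, r < i → w i = 0) :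
    ∑ i : Fin m, (1 + C / c) ^ ((i : ℕ) + 1) * w i ≤ -(c * (1 + C / c)) := by
  set k := 1 + C / c with hk
  have hck : c * k = c + C := by rw [hk]; field_simp
  have hk0 : 0 ≤ k := by positivity
  let u : ℕ → ℝ := fun i => if i < r then C else if i = r then -c else 0
  have key : ∀ N : ℕ, ∑ i ∈ Finset.range N, k ^ (i + 1) * u i =
      if N ≤ r then c * k ^ (N + 1) - c * k else -(c * k) := by
    intro N
    induction N with
    | zero => simp
    | succ N ih =>
      rw [Finset.sum_range_succ, ih]
      rcases lt_trichotomy N r with h | h | h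
      · rw [if_pos h.le, if_pos (Nat.succ_le_of_lt h)]
        simp only [u, if_pos h]
        linear_combination (-k ^ (N + 1)) * hck
      · rw [if_pos h.le, if_neg (by omega)]
        simp only [u, h, lt_irrefl, if_false, if_true]
        ring
      · rw [if_neg (by omega), if_neg (by omega)]
        simp [u, h.not_gt, h.ne']
  calc ∑ i : Fin m, k ^ ((i : ℕ) + 1) * w i
      ≤ ∑ i : Fin m, k ^ ((i : ℕ) + 1) * u i := by
        refine Finset.sum_le_sum fun i _ => mul_le_mul_of_nonneg_left ?_ (pow_nonneg hk0 _)
        rcases lt_trichotomy i r with h | h | h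
        · simpa [u, h] using hw i
        · simpa [u, h] using hr
        · have h' : (r : ℕ) < i := h
          simp [u, h'.not_gt, h'.ne', h0 i h]
    _ = -(c * k) := by
        rw [Fin.sum_univ_eq_sum_range (fun i => k ^ (i + 1) * u i), key, if_neg (by omega)]

theorem sum_mul_update {m n : ℕ} (A : Matrix (Fin m) (Fin n) ℝ) (x : Fin n → ℝ) (j : Fin n)
    (s : ℝ) (i : Fin m) :
    ∑ l, A i l * Function.update x j s l = ∑ l, A i l * x l + A i j * (s - x j) := by
  classical
  rw [← sub_eq_iff_eq_add', ← Finset.sum_sub_distrib, Finset.sum_eq_single j]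
  · simp [mul_sub]
  · intro l _ hl
    simp [hl]
  · simp

theorem le_g {m n : ℕ} (A : Matrix (Fin m) (Fin n) ℝ) (b : Fin m → ℝ) {j : Fin n}
    (x : Fin n → ℝ) {i : Fin m} (hi : A i j ≠ 0) : ∑ l, A i l * x l + b i ≤ g A b j x :=
  le_ciSup (f := fun i : {i : Fin m // A i j ≠ 0} => ∑ l, A i.1 l * x l + b i.1)
    (Set.finite_range _).bddAbove ⟨i, hi⟩

/-- At a minimizer of `g_j` along coordinate `j`, the maximum is attained by a row whose slope
opposes any prescribed direction. -/
theorem exists_active_of_isMin {m n : ℕ} (A : Matrix (Fin m) (Fin n) ℝ) (b : Fin m → ℝ)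
    (j : Fin n) (hA : ∃ i, A i j ≠ 0) (x : Fin n → ℝ)
    (hmin : ∀ s : ℝ, g A b j x ≤ g A b j (Function.update x j s)) {d : ℝ} (hd : d ≠ 0) :
    ∃ q, A q j * d < 0 ∧ ∑ l, A q l * x l + b q = g A b j x := by
  by_contra! hcon
  have hev : ∀ᶠ η : ℝ in nhdsWithin 0 (Set.Ioi 0), ∀ i : {i : Fin m // A i j ≠ 0},
      ∑ l, A i.1 l * x l + b i.1 - η * (A i.1 j * d) < g A b j x := by
    rw [eventually_all]
    rintro ⟨i, hi⟩
    have hle := le_g A b x hi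
    rcases lt_or_gt_of_ne (mul_ne_zero hi hd) with h | h
    · have hlt := lt_of_le_of_ne hle (hcon i h)
      have hcont : Continuous fun η : ℝ => ∑ l, A i l * x l + b i - η * (A i j * d) := by
        fun_prop
      exact nhdsWithin_le_nhds
        (hcont.continuousAt.eventually_lt continuousAt_const (by simpa using hlt))
    · filter_upwards [self_mem_nhdsWithin] with η hη
      have : 0 < η * (A i j * d) := mul_pos hη h
      linarith
  obtain ⟨η, hη⟩ := hev.exists
  obtain ⟨i₀, hi₀⟩ := hA
  have : Nonempty {i : Fin m // A i j ≠ 0} := ⟨⟨i₀, hi₀⟩⟩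
  obtain ⟨i, hi⟩ := exists_eq_ciSup_of_finite (f := fun i : {i : Fin m // A i j ≠ 0} =>
    ∑ l, A i.1 l * Function.update x j (x j - η * d) l + b i.1)
  have h1 := hmin (x j - η * d)
  have h2 := hη i
  rw [g.eq_def A b j (Function.update _ _ _), ← hi] at h1
  simp only [sum_mul_update] at h1
  linarith

/-- A coordinate-descent step of length `|d|` lowers the energy by at least
`c * (1 + C / c) * |d|`. -/
theorem energy_step {m n : ℕ} (A : Matrix (Fin m) (Fin n) ℝ) (b : Fin m → ℝ) {c C : ℝ}
    (hc : 0 < c) (hC : 0 ≤ C) (hcA : ∀ i j, A i j ≠ 0 → c ≤ |A i j|) (hCA : ∀ i j, |A i j| ≤ C)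
    (j : Fin n) (hA : ∃ i, A i j ≠ 0) (x x' : Fin n → ℝ) (hagree : ∀ l, l ≠ j → x' l = x l)
    (hmin : ∀ s : ℝ, g A b j x' ≤ g A b j (Function.update x j s)) :
    c * (1 + C / c) * |x' j - x j| ≤
      energy m (1 + C / c) (fun i => ∑ l, A i l * x l + b i) -
        energy m (1 + C / c) (fun i => ∑ l, A i l * x' l + b i) := by
  have hk : 1 ≤ 1 + C / c := le_add_of_nonneg_right (by positivity)
  have hx' : x' = Function.update x j (x' j) := by
    ext l
    by_cases h : l = j
    · subst h; simp
    · simp [h, hagree l h]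
  generalize hd : x' j - x j = d
  have hy : ∀ i, ∑ l, A i l * x' l + b i = ∑ l, A i l * x l + b i + A i j * d := by
    intro i
    rw [hx', sum_mul_update, hd]
    ring
  rcases eq_or_ne d 0 with rfl | hd0
  · simp [hy]
  have hmin' : ∀ s : ℝ, g A b j x' ≤ g A b j (Function.update x' j s) := by
    intro s
    have : Function.update x' j s = Function.update x j s := by rw [hx']; simp
    rw [this]
    exact hmin s
  obtain ⟨q, hq, hqg⟩ := exists_active_of_isMin A b j hA x' hmin' hd0
  have hq0 : A q j ≠ 0 := fun h => by simp [h] at hq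
  obtain ⟨τ, r, hτr, hτ, hE⟩ := exists_perm_energy_eq (1 + C / c)
    (fun i => ∑ l, A i l * x' l + b i) {i | A i j ≠ 0} hq0
    (fun i hi => (le_g A b x' hi).trans_eq hqg.symm)
  have hle := sum_perm_le_energy hk (fun i => ∑ l, A i l * x l + b i) τ
  have hdpos : 0 < |d| := abs_pos.2 hd0
  have hgeo := sum_pow_mul_le (mul_pos hc hdpos) (mul_nonneg hC hdpos.le)
    (fun i => A (τ i) j * d) r
    (fun i => (le_abs_self _).trans (by
      rw [abs_mul]; exact mul_le_mul_of_nonneg_right (hCA _ _) hdpos.le))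
    (by
      have h1 := mul_le_mul_of_nonneg_right (hcA q j hq0) hdpos.le
      rw [← abs_mul, abs_of_neg hq] at h1
      simp only [hτr]
      linarith)
    (fun i hi => by
      have : A (τ i) j = 0 := by simpa using hτ i hi
      simp [this])
  rw [mul_div_mul_right _ _ hdpos.ne'] at hgeo
  simp only [hy, mul_add _ _ (A _ j * d), Finset.sum_add_distrib] at hE hle hgeo
  simp only [hy]
  linarith

/-- along coordinate-descent iterates `x^t` (each step updates coordinate `j_t`
to the minimizer of `t' ↦ g_{j_t}`), if the energy `E_{1+C/c}(Ax^t+b)` is bounded below,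
then `x^t` converges to some `x*`, and consequently `Ax^t + b` converges to `Ax* + b`. -/
theorem coordinate_descent_converges (m n : ℕ) (A : Matrix (Fin m) (Fin n) ℝ)
    (b : Fin m → ℝ) (hsc : SignConsistent A) (c C : ℝ)
    (hc : IsLeast {r : ℝ | ∃ i j, A i j ≠ 0 ∧ r = |A i j|} c)
    (hC : IsGreatest {r : ℝ | ∃ i j, r = |A i j|} C)
    (x : ℕ → Fin n → ℝ) (jseq : ℕ → Fin n)
    (hagree : ∀ t : ℕ, ∀ k : Fin n, k ≠ jseq t → x (t + 1) k = x t k)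
    (hmin : ∀ t : ℕ, ∀ s : ℝ,
      g A b (jseq t) (x (t + 1)) ≤ g A b (jseq t) (Function.update (x t) (jseq t) s))
    (Emin : ℝ)
    (hEmin : ∀ t : ℕ, Emin ≤ energy m (1 + C / c) (fun i => ∑ l, A i l * x t l + b i)) :
    ∃ xstar : Fin n → ℝ,
      Tendsto x atTop (nhds xstar) ∧
      Tendsto (fun t : ℕ => fun i : Fin m => ∑ l, A i l * x t l + b i) atTop
        (nhds (fun i : Fin m => ∑ l, A i l * xstar l + b i)) := by
  have hcpos : 0 < c := by
    obtain ⟨i, j, hij, rfl⟩ := hc.1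
    exact abs_pos.2 hij
  have hCnn : 0 ≤ C := by
    obtain ⟨i, j, rfl⟩ := hC.1
    exact abs_nonneg _
  set E : ℕ → ℝ := fun t => energy m (1 + C / c) (fun i => ∑ l, A i l * x t l + b i)
  set K := c * (1 + C / c)
  have hK : 0 < K := by positivity
  have hstep : ∀ t, K * |x (t + 1) (jseq t) - x t (jseq t)| ≤ E t - E (t + 1) := fun t =>
    energy_step A b hcpos hCnn (fun i j h => hc.2 ⟨i, j, h, rfl⟩) (fun i j => hC.2 ⟨i, j, rfl⟩)
      (jseq t) ((hsc (jseq t)).1.imp fun _ h => h.ne) (x t) (x (t + 1)) (hagree t) (hmin t)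
  have hsum : Summable fun t => |x (t + 1) (jseq t) - x t (jseq t)| := by
    refine summable_of_sum_range_le (c := (E 0 - Emin) / K) (fun _ => abs_nonneg _) fun N => ?_
    rw [le_div_iff₀' hK, Finset.mul_sum]
    calc _ ≤ ∑ t ∈ Finset.range N, (E t - E (t + 1)) := Finset.sum_le_sum fun t _ => hstep t
      _ = E 0 - E N := Finset.sum_range_sub' E N
      _ ≤ E 0 - Emin := sub_le_sub_left (hEmin N) _
  have hdist : ∀ t, dist (x t) (x (t + 1)) ≤ |x (t + 1) (jseq t) - x t (jseq t)| := by
    intro t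
    refine (dist_pi_le_iff (abs_nonneg _)).2 fun l => ?_
    by_cases h : l = jseq t
    · rw [h, dist_comm, Real.dist_eq]
    · rw [hagree t l h, dist_self]
      exact abs_nonneg _
  obtain ⟨xstar, hx⟩ := cauchySeq_tendsto_of_complete
    (cauchySeq_of_dist_le_of_summable _ hdist hsum)
  refine ⟨xstar, hx, ?_⟩
  have hcont : Continuous fun (z : Fin n → ℝ) (i : Fin m) => ∑ l, A i l * z l + b i := by
    fun_prop
  exact (hcont.tendsto xstar).comp hx
end

section
/- Let (V,E) be a finite undirected graph, L a finite nonempty label set, θ a weight vector, and δ a message vector with reparameterization θ^δ defined by θ^δ_{i,x} = θ_{i,x} − Σ_{j ∈ N_i} δ_{ij,x} and θ^δ_{ij,xy} = θ_{ij,xy} + δ_{ij,x} + δ_{ji,y}. Fix i ∈ V, a neighbor j of i, and x ∈ L, and let δ' equal δ except δ'_{ij,x} = δ_{ij,x} + (1/2)(θ^δ_{i,x} − max_{y ∈ L} θ^δ_{ij,xy}). Then θ^{δ'}_{i,x} = max_{y ∈ L} θ^{δ'}_{ij,xy}, and this common value equals the minimum over d ∈ ℝ of max{ θ^δ_{i,x}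 − d, max_{y ∈ L} θ^δ_{ij,xy} + d }. -/
/-- The neighbours of `i` in the graph whose edge set is given by the finset `E` of
(one orientation of each) edge. -/
def nbrs {V : Type*} [Fintype V] [DecidableEq V] (E : Finset (V × V)) (i : V) : Finset V :=
  Finset.univ.filter (fun j => (i, j) ∈ E ∨ (j, i) ∈ E)

/-- Reparameterized unary weight `θ^δ_{i,x} = θ_{i,x} − ∑_{j ∈ N_i} δ_{ij,x}`. -/
def repU {V L : Type*} [Fintype V] [DecidableEq V] (E : Finset (V × V))
    (θ1 : V → L → ℝ) (δ : V → V → L → ℝ) (i : V) (x : L) : ℝ :=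
  θ1 i x - ∑ j ∈ nbrs E i, δ i j x

/-- Reparameterized binary weight `θ^δ_{ij,xy} = θ_{ij,xy} + δ_{ij,x} + δ_{ji,y}`. -/
def repP {V L : Type*} (θ2 : V → V → L → L → ℝ) (δ : V → V → L → ℝ)
    (i j : V) (x y : L) : ℝ :=
  θ2 i j x y + δ i j x + δ j i y

/-- the max-sum diffusion update
`δ'_{ij,x} = δ_{ij,x} + ½(θ^δ_{i,x} − max_y θ^δ_{ij,xy})` (all other messages unchanged)
enforces `θ^{δ'}_{i,x} = max_y θ^{δ'}_{ij,xy}`, and this common value is the minimum over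
`d ∈ ℝ` of `max{θ^δ_{i,x} − d, max_y θ^δ_{ij,xy} + d}`. -/
theorem msd_update {V L : Type*} [Fintype V] [DecidableEq V] [Fintype L] [Nonempty L]
    (E : Finset (V × V))
    (hirr : ∀ p ∈ E, p.1 ≠ p.2)
    (hanti : ∀ p ∈ E, (p.2, p.1) ∉ E)
    (θ1 : V → L → ℝ) (θ2 : V → V → L → L → ℝ)
    (hsym : ∀ i' j' x' y', θ2 i' j' x' y' = θ2 j' i' y' x')
    (i j : V) (hadj : (i, j) ∈ E ∨ (j, i) ∈ E) (x : L)
    (δ δ' : V → V → L → ℝ)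
    (hδ'ne : ∀ i' j' x', (i', j', x') ≠ (i, j, x) → δ' i' j' x' = δ i' j' x')
    (hδ'eq : δ' i j x
      = δ i j x + (repU E θ1 δ i x - ⨆ y : L, repP θ2 δ i j x y) / 2) :
    repU E θ1 δ' i x = (⨆ y : L, repP θ2 δ' i j x y) ∧
    repU E θ1 δ' i x
      = ⨅ d : ℝ, max (repU E θ1 δ i x - d) ((⨆ y : L, repP θ2 δ i j x y) + d) := by
  have hij : i ≠ j := by
    rcases hadj with h | h
    · exact hirr _ h
    · exact (hirr _ h).symm
  set a := repU E θ1 δ i x with ha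
  set b := ⨆ y : L, repP θ2 δ i j x y with hb
  have hmem : j ∈ nbrs E i := by simpa [nbrs] using hadj
  have hU : repU E θ1 δ' i x = (a + b) / 2 := by
    have hsum : ∑ k ∈ (nbrs E i).erase j, δ' i k x = ∑ k ∈ (nbrs E i).erase j, δ i k x := by
      refine Finset.sum_congr rfl fun k hk => hδ'ne i k x fun h => ?_
      simp only [Prod.mk.injEq, true_and, and_true] at h
      exact Finset.ne_of_mem_erase hk h
    have h1 := Finset.add_sum_erase (nbrs E i) (fun k => δ i k x) hmem
    have h2 := Finset.add_sum_erase (nbrs E i) (fun k => δ' i k x) hmem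
    simp only [repU] at ha ⊢
    linarith
  have hP : (⨆ y : L, repP θ2 δ' i j x y) = (a + b) / 2 := by
    have hshift : ∀ y, repP θ2 δ' i j x y = repP θ2 δ i j x y + (a - b) / 2 := by
      intro y
      have h : δ' j i y = δ j i y :=
        hδ'ne j i y fun h => hij (Prod.mk.inj h).1.symm
      simp only [repP, h, hδ'eq]
      ring
    simp only [hshift]
    rw [← ciSup_add (Set.finite_range _).bddAbove, ← hb]
    ring
  refine ⟨hU.trans hP.symm, ?_⟩
  have hlower : ∀ d : ℝ, (a + b) / 2 ≤ max (a - d) (b + d) := by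
    intro d
    linarith [le_max_left (a - d) (b + d), le_max_right (a - d) (b + d)]
  rw [hU]
  refine le_antisymm (le_ciInf hlower) ?_
  refine (ciInf_le ⟨_, Set.forall_mem_range.2 hlower⟩ ((a - b) / 2)).trans ?_
  exact max_le (by linarith) (by linarith)
end

section
/- Let I be a finite set, M ⊆ {0,1}^I, i ∈ I with {μ ∈ M : μ_i = 1} nonempty (and finite), and define F_i(θ) = max_{μ ∈ M, μ_i = 1} ⟨θ, μ⟩. Let θ_s, θ_t ∈ ℝ^I and set d = (1/2)(F_i(θ_t) − F_i(θ_s)). Then F_i(θ_s + d·e_i) = F_i(θ_t − d·e_i), and this common value equals the minimum over d' ∈ ℝ of max{ F_i(θ_s + d'·e_i), F_i(θ_t − d'·e_i) }. -/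
/-- The max-marginal `F_i(θ) = max_{μ ∈ M, μ_i = 1} ⟨θ, μ⟩`. -/
noncomputable def maxMarg {I : Type*} [Fintype I] (M : Set (I → ℝ)) (i : I)
    (θ : I → ℝ) : ℝ :=
  ⨆ μ : {μ : I → ℝ // μ ∈ M ∧ μ i = 1}, ∑ l, θ l * μ.1 l

/-- Shifting the `i`-th coordinate of `θ` by `d` shifts the max-marginal `F_i` by `d`. -/
theorem maxMarg_add_smul_single {I : Type*} [Fintype I] [DecidableEq I]
    {M : Set (I → ℝ)} {i : I}
    (hne : {μ ∈ M | μ i = 1}.Nonempty) (hfin : {μ ∈ M | μ i = 1}.Finite)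
    (θ : I → ℝ) (d : ℝ) :
    maxMarg M i (θ + d • (Pi.single i 1 : I → ℝ)) = maxMarg M i θ + d := by
  have : Nonempty {μ : I → ℝ // μ ∈ M ∧ μ i = 1} := hne.to_subtype
  have : Finite {μ : I → ℝ // μ ∈ M ∧ μ i = 1} := hfin.to_subtype
  unfold maxMarg
  rw [ciSup_add (Set.finite_range _).bddAbove]
  refine iSup_congr fun μ => ?_
  simp [add_mul, Finset.sum_add_distrib, Pi.single_apply, μ.2.2]

/-- the max-marginal averaging update with
`d = ½(F_i(θ_t) − F_i(θ_s))` equalizes the two max-marginals, and the common value is the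
minimum over `d' ∈ ℝ` of `max{F_i(θ_s + d'·e_i), F_i(θ_t − d'·e_i)}`. -/
theorem maxMarg_averaging_update {I : Type*} [Fintype I] [DecidableEq I]
    (M : Set (I → ℝ)) (hM01 : ∀ μ ∈ M, ∀ l : I, μ l = 0 ∨ μ l = 1)
    (i : I)
    (hne : {μ ∈ M | μ i = 1}.Nonempty)
    (hfin : {μ ∈ M | μ i = 1}.Finite)
    (θs θt : I → ℝ) :
    maxMarg M i (θs + ((maxMarg M i θt - maxMarg M i θs) / 2) • (Pi.single i 1 : I → ℝ))
      = maxMarg M i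
          (θt - ((maxMarg M i θt - maxMarg M i θs) / 2) • (Pi.single i 1 : I → ℝ)) ∧
    maxMarg M i (θs + ((maxMarg M i θt - maxMarg M i θs) / 2) • (Pi.single i 1 : I → ℝ))
      = ⨅ d' : ℝ, max (maxMarg M i (θs + d' • (Pi.single i 1 : I → ℝ)))
          (maxMarg M i (θt - d' • (Pi.single i 1 : I → ℝ))) := by
  have h_sub (d : ℝ) :
      maxMarg M i (θt - d • (Pi.single i 1 : I → ℝ)) = maxMarg M i θt - d := by
    rw [sub_eq_add_neg, ← neg_smul, maxMarg_add_smul_single hne hfin, ← sub_eq_add_neg]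
  simp only [h_sub, maxMarg_add_smul_single hne hfin]
  set a := maxMarg M i θs
  set b := maxMarg M i θt
  refine ⟨by ring, le_antisymm (le_ciInf fun d' => ?_) ?_⟩
  · linarith [le_max_left (a + d') (b - d'), le_max_right (a + d') (b - d')]
  · have h_bdd : BddBelow (Set.range fun d' : ℝ => max (a + d') (b - d')) := by
      refine ⟨(a + b) / 2, ?_⟩
      rintro _ ⟨d', rfl⟩
      dsimp only
      linarith [le_max_left (a + d') (b - d'), le_max_right (a + d') (b - d')]
    refine (ciInf_le h_bdd ((b - a) / 2)).trans (max_le le_rfl ?_)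
    linarith
end

section
/- Let M ⊆ ℝ^3 be the set of 12 points {(−2,0,0), (2,0,0), (0,−1,0), (0,3,0), (0,1,−1), (0,1,3), (−1,1,1), (3,1,1), (1,−2,1), (1,2,1), (1,0,−2), (1,0,2)}. Then every point of M is an extreme point of the convex hull of M. -/
/-- The 12 points of the counterexample. -/
def Mset : Set (Fin 3 → ℝ) :=
  {![-2, 0, 0], ![2, 0, 0], ![0, -1, 0], ![0, 3, 0], ![0, 1, -1], ![0, 1, 3],
   ![-1, 1, 1], ![3, 1, 1], ![1, -2, 1], ![1, 2, 1], ![1, 0, -2], ![1, 0, 2]}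

/-- A point of `s` that is the unique maximizer over `s` of a linear functional is an extreme point
of the convex hull of `s`. -/
theorem mem_extremePoints_convexHull_of_unique_max {E : Type*} [AddCommGroup E] [Module ℝ E]
    {s : Set E} {p : E} (hp : p ∈ s) (f : E →ₗ[ℝ] ℝ) (hf : ∀ q ∈ s, q = p ∨ f q < f p) :
    p ∈ Set.extremePoints ℝ (convexHull ℝ s) := by
  have hconv : Convex ℝ {x : E | x = p ∨ f x < f p} := by
    rw [convex_iff_forall_pos]
    rintro x hx y hy a b ha hb hab
    simp only [Set.mem_ofPred_eq, map_add, map_smul, smul_eq_mul] at hx hy ⊢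
    have hb' : b = 1 - a := by linarith
    rcases hx with rfl | hx
    · rcases hy with rfl | hy
      · left
        rw [← add_smul, hab, one_smul]
      · right
        subst hb'
        nlinarith
    · right
      have hy' : f y ≤ f p := by
        rcases hy with rfl | hy
        · exact le_rfl
        · exact hy.le
      subst hb'
      nlinarith [mul_pos ha (sub_pos.2 hx), mul_nonneg hb.le (sub_nonneg.2 hy')]
  have hsub : ∀ x ∈ convexHull ℝ s, x = p ∨ f x < f p := convexHull_min hf hconv
  refine mem_extremePoints_iff_left.2 ⟨subset_convexHull ℝ s hp, ?_⟩
  rintro x hx y hy ⟨a, b, ha, hb, hab, hxy⟩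
  refine (hsub x hx).resolve_right fun hlt => ?_
  have hy' : f y ≤ f p := by
    rcases hsub y hy with rfl | h
    · exact le_rfl
    · exact h.le
  have heq := congrArg f hxy
  simp only [map_add, map_smul, smul_eq_mul] at heq
  have hb' : b = 1 - a := by linarith
  subst hb'
  nlinarith [mul_pos ha (sub_pos.2 hlt), mul_nonneg hb.le (sub_nonneg.2 hy')]

/-- every point of `M` is an extreme point of `conv M`. -/
theorem Mset_extremePoints :
    ∀ p ∈ Mset, p ∈ Set.extremePoints ℝ (convexHull ℝ Mset) := by
  intro p hp
  have key := fun v : Fin 3 → ℝ =>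
    mem_extremePoints_convexHull_of_unique_max hp (dotProductBilin ℝ ℝ v)
  simp only [dotProductBilin_apply_apply, Mset, Set.mem_insert_iff, Set.mem_singleton_iff, forall_eq_or_imp, forall_eq] at hp key
  rcases hp with rfl | rfl | rfl | rfl | rfl | rfl | rfl | rfl | rfl | rfl | rfl | rfl
  · exact key ![-1, 0, 0] (by norm_num [Matrix.vec3_dotProduct'])
  · exact key ![9, -6, -4] (by norm_num [Matrix.vec3_dotProduct'])
  · exact key ![-4, -9, -6] (by norm_num [Matrix.vec3_dotProduct'])
  · exact key ![0, 1, 0] (by norm_num [Matrix.vec3_dotProduct'])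
  · exact key ![-6, 4, -9] (by norm_num [Matrix.vec3_dotProduct'])
  · exact key ![0, 0, 1] (by norm_num [Matrix.vec3_dotProduct'])
  · exact key ![-9, 6, 4] (by norm_num [Matrix.vec3_dotProduct'])
  · exact key ![1, 0, 0] (by norm_num [Matrix.vec3_dotProduct'])
  · exact key ![0, -1, 0] (by norm_num [Matrix.vec3_dotProduct'])
  · exact key ![4, 9, 6] (by norm_num [Matrix.vec3_dotProduct'])
  · exact key ![0, 0, -1] (by norm_num [Matrix.vec3_dotProduct'])
  · exact key ![6, -4, 9] (by norm_num [Matrix.vec3_dotProduct'])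
end

section
/- Let M ⊆ ℝ^3 be the set of 12 points {(−2,0,0), (2,0,0), (0,−1,0), (0,3,0), (0,1,−1), (0,1,3), (−1,1,1), (3,1,1), (1,−2,1), (1,2,1), (1,0,−2), (1,0,2)} and let K = conv M. Then the following six coordinate sections of K are segments: {z ∈ K : z_2 = 0, z_3 = 0} = [(−2,0,0),(2,0,0)]; {z ∈ K : z_1 = 0, z_3 = 0} = [(0,−1,0),(0,3,0)]; {z ∈ K : z_1 = 0, z_2 = 1} = [(0,1,−1),(0,1,3)]; {z ∈ K : z_2 = 1, z_3 = 1} = [(−1,1,1),(3,1,1)]; {z ∈ K : z_1 = 1, z_3 = 1} = [(1,−2,1),(1,2,1)]; {z ∈ K : z_1 = 1, z_2 = 0} = [(1,0,−2),(1,0,2)]. Consequently, coordinate descent on K with the mid-point rule (each update replaces the current coordinate by the midpoint of the interval of feasible values of that coordinate, the other coordinates fixed), started at (0,0,0) and updating coordinates 1,2,3 cyclically, produces the periodic cycle (0,0,0) → (0,0,0) → (0,1,0) → (0,1,1) → (1,1,1) → (1,0,1) → (1,0,0) → (0,0,0). -/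
/-- The mid-point-rule coordinate-descent update on `K`: coordinate `j` of `x` is replaced
by the midpoint of the interval of values `t` such that the point obtained from `x` by
setting its `j`-th coordinate to `t` lies in `K`. -/
noncomputable def mpUpd (K : Set (Fin 3 → ℝ)) (j : Fin 3) (x : Fin 3 → ℝ) : Fin 3 → ℝ :=
  Function.update x j
    ((sInf {t : ℝ | Function.update x j t ∈ K} +
      sSup {t : ℝ | Function.update x j t ∈ K}) / 2)

/-- A closed half-space containing `Mset` contains its convex hull. -/
lemma linear_le_of_mem_convexHull_Mset {a b c v : ℝ}
    (h : ∀ q ∈ Mset, a * q 0 + b * q 1 + c * q 2 ≤ v)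
    {z : Fin 3 → ℝ} (hz : z ∈ convexHull ℝ Mset) : a * z 0 + b * z 1 + c * z 2 ≤ v := by
  have hconv : Convex ℝ {z : Fin 3 → ℝ | a * z 0 + b * z 1 + c * z 2 ≤ v} :=
    convex_halfSpace_le ⟨fun x y => by simp only [Pi.add_apply]; ring,
      fun r x => by simp only [Pi.smul_apply, smul_eq_mul]; ring⟩ v
  exact convexHull_min h hconv hz

/-- A convex set meets a coordinate line in an interval, determined by its end points. -/
lemma Convex.setOf_update_mem_eq_Icc {ι : Type*} [DecidableEq ι] {K : Set (ι → ℝ)}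
    (hK : Convex ℝ K) {p : ι → ℝ} {j : ι} {l u : ℝ} (hl : Function.update p j l ∈ K)
    (hu : Function.update p j u ∈ K)
    (hbound : ∀ t, Function.update p j t ∈ K → l ≤ t ∧ t ≤ u) :
    {t : ℝ | Function.update p j t ∈ K} = Set.Icc l u := by
  refine Set.Subset.antisymm hbound fun t ht => ?_
  apply hK.segment_subset hl hu
  rw [← Pi.image_update_segment, segment_eq_Icc (hbound l hl).2]
  exact Set.mem_image_of_mem _ ht

/-- The section of a set by a coordinate line is a segment if it is an interval in the
coordinate along the line. -/
lemma setOf_mem_and_eq_segment {ι : Type*} [DecidableEq ι] {K : Set (ι → ℝ)} {p : ι → ℝ}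
    {j : ι} {l u : ℝ} (hlu : l ≤ u)
    (h : {t : ℝ | Function.update p j t ∈ K} = Set.Icc l u) :
    {z ∈ K | ∀ i, i ≠ j → z i = p i} =
      segment ℝ (Function.update p j l) (Function.update p j u) := by
  rw [← Pi.image_update_segment, segment_eq_Icc hlu, ← h]
  ext z
  constructor
  · rintro ⟨hz, hp⟩
    have hzp : Function.update p j (z j) = z := by
      rw [Function.update_eq_iff]
      exact ⟨rfl, fun i hi => (hp i hi).symm⟩
    exact ⟨z j, by rwa [Set.mem_ofPred_eq, hzp], hzp⟩
  · rintro ⟨t, ht, rfl⟩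
    exact ⟨ht, fun i hi => Function.update_of_ne hi _ _⟩

lemma mpUpd_eq_update {K : Set (Fin 3 → ℝ)} {p : Fin 3 → ℝ} {j : Fin 3} {l u : ℝ}
    (hlu : l ≤ u) (h : {t : ℝ | Function.update p j t ∈ K} = Set.Icc l u) :
    mpUpd K j p = Function.update p j ((l + u) / 2) := by
  rw [mpUpd, h, csInf_Icc hlu, csSup_Icc hlu]

@[simp] lemma update_vec3_zero (a b c t : ℝ) : Function.update ![a, b, c] 0 t = ![t, b, c] := by
  ext i; fin_cases i <;> rfl

@[simp] lemma update_vec3_one (a b c t : ℝ) : Function.update ![a, b, c] 1 t = ![a, t, c] := by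
  ext i; fin_cases i <;> rfl

@[simp] lemma update_vec3_two (a b c t : ℝ) : Function.update ![a, b, c] 2 t = ![a, b, t] := by
  ext i; fin_cases i <;> rfl

/-- Valid inequalities for `convexHull ℝ Mset`, one supporting each point of `Mset`. -/
lemma inequalities_of_mem_convexHull_Mset {x y z : ℝ} (h : ![x, y, z] ∈ convexHull ℝ Mset) :
    (-2 ≤ x ∧ 2 * x - y - z ≤ 4) ∧ (-x - 2 * y - z ≤ 2 ∧ y ≤ 3) ∧
    (-x + y - 2 * z ≤ 3 ∧ z ≤ 3) ∧ (-2 * x + y + z ≤ 4 ∧ x ≤ 3) ∧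
    (-2 ≤ y ∧ x + 2 * y + z ≤ 6) ∧ (-2 ≤ z ∧ x - y + 2 * z ≤ 5) := by
  have key (a b c v : ℝ) (hq : ∀ q ∈ Mset, a * q 0 + b * q 1 + c * q 2 ≤ v) :
      a * x + b * y + c * z ≤ v := by
    simpa using linear_le_of_mem_convexHull_Mset hq h
  refine ⟨⟨?_, ?_⟩, ⟨?_, ?_⟩, ⟨?_, ?_⟩, ⟨?_, ?_⟩, ⟨?_, ?_⟩, ⟨?_, ?_⟩⟩
  · linarith [key (-1) 0 0 2 (by norm_num [Mset, Matrix.cons_val_two])]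
  · linarith [key 2 (-1) (-1) 4 (by norm_num [Mset, Matrix.cons_val_two])]
  · linarith [key (-1) (-2) (-1) 2 (by norm_num [Mset, Matrix.cons_val_two])]
  · linarith [key 0 1 0 3 (by norm_num [Mset, Matrix.cons_val_two])]
  · linarith [key (-1) 1 (-2) 3 (by norm_num [Mset, Matrix.cons_val_two])]
  · linarith [key 0 0 1 3 (by norm_num [Mset, Matrix.cons_val_two])]
  · linarith [key (-2) 1 1 4 (by norm_num [Mset, Matrix.cons_val_two])]
  · linarith [key 1 0 0 3 (by norm_num [Mset, Matrix.cons_val_two])]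
  · linarith [key 0 (-1) 0 2 (by norm_num [Mset, Matrix.cons_val_two])]
  · linarith [key 1 2 1 6 (by norm_num [Mset, Matrix.cons_val_two])]
  · linarith [key 0 0 (-1) 2 (by norm_num [Mset, Matrix.cons_val_two])]
  · linarith [key 1 (-1) 2 5 (by norm_num [Mset, Matrix.cons_val_two])]

/-- the six coordinate sections of `K = conv M` are the indicated segments,
and consequently coordinate descent with the mid-point rule, started at `(0,0,0)` and
updating coordinates `1,2,3` cyclically, cycles:
`(0,0,0) → (0,0,0) → (0,1,0) → (0,1,1) → (1,1,1) → (1,0,1) → (1,0,0) → (0,0,0)`. -/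
theorem midpoint_rule_cycles :
    ({z ∈ convexHull ℝ Mset | z 1 = 0 ∧ z 2 = 0}
        = segment ℝ ![-2, 0, 0] ![2, 0, 0]) ∧
    ({z ∈ convexHull ℝ Mset | z 0 = 0 ∧ z 2 = 0}
        = segment ℝ ![0, -1, 0] ![0, 3, 0]) ∧
    ({z ∈ convexHull ℝ Mset | z 0 = 0 ∧ z 1 = 1}
        = segment ℝ ![0, 1, -1] ![0, 1, 3]) ∧
    ({z ∈ convexHull ℝ Mset | z 1 = 1 ∧ z 2 = 1}
        = segment ℝ ![-1, 1, 1] ![3, 1, 1]) ∧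
    ({z ∈ convexHull ℝ Mset | z 0 = 1 ∧ z 2 = 1}
        = segment ℝ ![1, -2, 1] ![1, 2, 1]) ∧
    ({z ∈ convexHull ℝ Mset | z 0 = 1 ∧ z 1 = 0}
        = segment ℝ ![1, 0, -2] ![1, 0, 2]) ∧
    (mpUpd (convexHull ℝ Mset) 0 ![0, 0, 0] = ![0, 0, 0]) ∧
    (mpUpd (convexHull ℝ Mset) 1 ![0, 0, 0] = ![0, 1, 0]) ∧
    (mpUpd (convexHull ℝ Mset) 2 ![0, 1, 0] = ![0, 1, 1]) ∧
    (mpUpd (convexHull ℝ Mset) 0 ![0, 1, 1] = ![1, 1, 1]) ∧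
    (mpUpd (convexHull ℝ Mset) 1 ![1, 1, 1] = ![1, 0, 1]) ∧
    (mpUpd (convexHull ℝ Mset) 2 ![1, 0, 1] = ![1, 0, 0]) ∧
    (mpUpd (convexHull ℝ Mset) 0 ![1, 0, 0] = ![0, 0, 0]) := by
  have hconv : Convex ℝ (convexHull ℝ Mset) := convex_convexHull ℝ Mset
  have hx : {t : ℝ | Function.update ![0, 0, 0] 0 t ∈ convexHull ℝ Mset} =
      Set.Icc (-2) 2 := by
    refine hconv.setOf_update_mem_eq_Icc (subset_convexHull ℝ _ (by simp [Mset]))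
      (subset_convexHull ℝ _ (by simp [Mset])) fun t ht => ?_
    have := inequalities_of_mem_convexHull_Mset (by simpa using ht)
    constructor <;> linarith
  have hy : {t : ℝ | Function.update ![0, 0, 0] 1 t ∈ convexHull ℝ Mset} =
      Set.Icc (-1) 3 := by
    refine hconv.setOf_update_mem_eq_Icc (subset_convexHull ℝ _ (by simp [Mset]))
      (subset_convexHull ℝ _ (by simp [Mset])) fun t ht => ?_
    have := inequalities_of_mem_convexHull_Mset (by simpa using ht)
    constructor <;> linarith
  have hz_zero_one : {t : ℝ | Function.update ![0, 1, 0] 2 t ∈ convexHull ℝ Mset} =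
      Set.Icc (-1) 3 := by
    refine hconv.setOf_update_mem_eq_Icc (subset_convexHull ℝ _ (by simp [Mset]))
      (subset_convexHull ℝ _ (by simp [Mset])) fun t ht => ?_
    have := inequalities_of_mem_convexHull_Mset (by simpa using ht)
    constructor <;> linarith
  have hx_one_one : {t : ℝ | Function.update ![0, 1, 1] 0 t ∈ convexHull ℝ Mset} =
      Set.Icc (-1) 3 := by
    refine hconv.setOf_update_mem_eq_Icc (subset_convexHull ℝ _ (by simp [Mset]))
      (subset_convexHull ℝ _ (by simp [Mset])) fun t ht => ?_
    have := inequalities_of_mem_convexHull_Mset (by simpa using ht)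
    constructor <;> linarith
  have hy_one_one : {t : ℝ | Function.update ![1, 1, 1] 1 t ∈ convexHull ℝ Mset} =
      Set.Icc (-2) 2 := by
    refine hconv.setOf_update_mem_eq_Icc (subset_convexHull ℝ _ (by simp [Mset]))
      (subset_convexHull ℝ _ (by simp [Mset])) fun t ht => ?_
    have := inequalities_of_mem_convexHull_Mset (by simpa using ht)
    constructor <;> linarith
  have hz_one_zero : {t : ℝ | Function.update ![1, 0, 1] 2 t ∈ convexHull ℝ Mset} =
      Set.Icc (-2) 2 := by
    refine hconv.setOf_update_mem_eq_Icc (subset_convexHull ℝ _ (by simp [Mset]))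
      (subset_convexHull ℝ _ (by simp [Mset])) fun t ht => ?_
    have := inequalities_of_mem_convexHull_Mset (by simpa using ht)
    constructor <;> linarith
  refine ⟨?_, ?_, ?_, ?_, ?_, ?_, ?_, ?_, ?_, ?_, ?_, ?_, ?_⟩
  · simpa [Fin.forall_fin_succ] using setOf_mem_and_eq_segment (by norm_num) hx
  · simpa [Fin.forall_fin_succ] using setOf_mem_and_eq_segment (by norm_num) hy
  · simpa [Fin.forall_fin_succ] using setOf_mem_and_eq_segment (by norm_num) hz_zero_one
  · simpa [Fin.forall_fin_succ] using setOf_mem_and_eq_segment (by norm_num) hx_one_one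
  · simpa [Fin.forall_fin_succ] using setOf_mem_and_eq_segment (by norm_num) hy_one_one
  · simpa [Fin.forall_fin_succ] using setOf_mem_and_eq_segment (by norm_num) hz_one_zero
  · rw [mpUpd_eq_update (by norm_num) hx]; norm_num
  · rw [mpUpd_eq_update (by norm_num) hy]; norm_num
  · rw [mpUpd_eq_update (by norm_num) hz_zero_one]; norm_num
  · rw [mpUpd_eq_update (by norm_num) hx_one_one]; norm_num
  · rw [mpUpd_eq_update (by norm_num) hy_one_one]; norm_num
  · rw [mpUpd_eq_update (by norm_num) hz_one_zero]; norm_num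
  · have hx' : {t : ℝ | Function.update ![1, 0, 0] 0 t ∈ convexHull ℝ Mset} = Set.Icc (-2) 2 := by
      simpa using hx
    rw [mpUpd_eq_update (by norm_num) hx']; norm_num
end
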